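/- Let 0 < α < 1. If the set M ⊆ ℝ^p is Borel measurable, non-random, satisfies Condition A with matrix C_n = X'X/n, and the minimum over d ∈ {−1,1}^p of the N(−n^{−1/2} C_n^{−1} Λ d, σ² C_n^{−1})-probability of M equals 1 − α, then the infimum over β ∈ ℝ^p of the probability that β lies in the set β̂_L − n^{−1/2} M (that is, {β̂_L − n^{−1/2} m : m ∈ M}) equals 1 − α. -/

import Mathlib

open MeasureTheory ProbabilityTheory Filter Matrix Set
open scoped ENNReal NNReal BigOperators

noncomputable section

/-- The set `A^d_C̄(m) = {z : ∀ j, d j * (C̄ m)_j ≤ d j * (C̄ z)_j and d j * z j ≤ 0}`. -/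
def Aset {p : ℕ} (Cb : Matrix (Fin p) (Fin p) ℝ) (d m : Fin p → ℝ) : Set (Fin p → ℝ) :=
  {z | ∀ j, d j * Cb.mulVec m j ≤ d j * Cb.mulVec z j ∧ d j * z j ≤ 0}

/-- A vector with entries in `{-1, 1}`. -/
def IsSignVec {p : ℕ} (d : Fin p → ℝ) : Prop := ∀ j, d j = 1 ∨ d j = -1

/-- Condition A with matrix `C̄`: `A^d_C̄(m) ⊆ M` for all sign vectors `d` and all `m ∈ M`. -/
def CondA {p : ℕ} (Cb : Matrix (Fin p) (Fin p) ℝ) (M : Set (Fin p → ℝ)) : Prop :=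
  ∀ d : Fin p → ℝ, IsSignVec d → ∀ m ∈ M, Aset Cb d m ⊆ M

/-- `μ` is the multivariate normal distribution on `ℝ^p` with mean `m` and
covariance matrix `S`, characterized via its one-dimensional projections. -/
def IsMvGaussian {p : ℕ} (μ : Measure (Fin p → ℝ)) (m : Fin p → ℝ)
    (S : Matrix (Fin p) (Fin p) ℝ) : Prop :=
  ∀ l : Fin p → ℝ,
    Measure.map (fun x => ∑ j, l j * x j) μ =
      gaussianReal (∑ j, l j * m j) (Real.toNNReal (l ⬝ᵥ S.mulVec l))

/-- The Lasso objective `‖y − Xb‖² + 2 Σ_j λ_j |b_j|`. -/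
def lassoObjective {n p : ℕ} (y : Fin n → ℝ) (X : Matrix (Fin n) (Fin p) ℝ)
    (lam : Fin p → ℝ) (b : Fin p → ℝ) : ℝ :=
  (∑ i, (y i - X.mulVec b i) ^ 2) + 2 * ∑ j, lam j * |b j|

/-- First-order conditions for a one-dimensional penalized quadratic. -/
lemma subgradient_of_le_penalized_quadratic {g a l b : ℝ}
    (h : ∀ t : ℝ, 2 * t * g ≤ t ^ 2 * a + 2 * l * (|b + t| - |b|)) :
    |g| ≤ |l| ∧ (0 < b → g = l) ∧ (b < 0 → g = -l) := by
  have key : ∀ x δ : ℝ, 0 < δ → (∀ t, 0 < t → t ≤ δ → x ≤ t * a) → x ≤ 0 := by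
    intro x δ hδ hx
    have h1 : Tendsto (fun t : ℝ => t * a) (nhdsWithin 0 (Ioi 0)) (nhds 0) := by
      have h2 : Continuous fun t : ℝ => t * a := by fun_prop
      simpa using (h2.tendsto 0).mono_left nhdsWithin_le_nhds
    refine ge_of_tendsto h1 ?_
    filter_upwards [Ioc_mem_nhdsGT hδ] with t ht using hx t ht.1 ht.2
  have hpos : 0 < b → g = l := by
    intro hb
    have h1 : 2 * (g - l) ≤ 0 := key _ 1 one_pos fun t ht _ => by
      have := h t
      rw [abs_of_pos hb, abs_of_pos (by linarith)] at this
      nlinarith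
    have h2 : 2 * (l - g) ≤ 0 := key _ b hb fun t ht htb => by
      have := h (-t)
      rw [abs_of_pos hb, abs_of_nonneg (by linarith)] at this
      nlinarith
    linarith
  have hneg : b < 0 → g = -l := by
    intro hb
    have h1 : 2 * (g + l) ≤ 0 := key _ (-b) (by linarith) fun t ht htb => by
      have := h t
      rw [abs_of_neg hb, abs_of_nonpos (by linarith)] at this
      nlinarith
    have h2 : 2 * (-l - g) ≤ 0 := key _ 1 one_pos fun t ht _ => by
      have := h (-t)
      rw [abs_of_neg hb, abs_of_neg (by linarith)] at this
      nlinarith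
    linarith
  refine ⟨?_, hpos, hneg⟩
  rcases lt_trichotomy b 0 with hb | rfl | hb
  · rw [hneg hb, abs_neg]
  · have h1 : 2 * (g - l) ≤ 0 := key _ 1 one_pos fun t ht _ => by
      have := h t
      rw [zero_add, abs_zero, abs_of_pos ht] at this
      nlinarith
    have h2 : 2 * (-g - l) ≤ 0 := key _ 1 one_pos fun t ht _ => by
      have := h (-t)
      rw [zero_add, abs_zero, abs_neg, abs_of_pos ht] at this
      nlinarith
    exact (abs_le.2 ⟨by linarith, by linarith⟩).trans (le_abs_self l)
  · rw [hpos hb]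

/-- The effect on the Lasso objective of moving a single coordinate. -/
lemma lassoObjective_add_single {n p : ℕ} (y : Fin n → ℝ) (X : Matrix (Fin n) (Fin p) ℝ)
    (lam b : Fin p → ℝ) (j : Fin p) (t : ℝ) :
    lassoObjective y X lam (b + Pi.single j t) = lassoObjective y X lam b
      - 2 * t * (Xᵀ *ᵥ (y - X *ᵥ b)) j + t ^ 2 * ∑ i, X i j ^ 2
      + 2 * lam j * (|b j + t| - |b j|) := by
  have h1 : ∑ i, (y i - (X *ᵥ (b + Pi.single j t)) i) ^ 2
      = ∑ i, (y i - (X *ᵥ b) i) ^ 2 - 2 * t * (Xᵀ *ᵥ (y - X *ᵥ b)) j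
        + t ^ 2 * ∑ i, X i j ^ 2 := by
    simp only [mulVec_add, mulVec_single, Pi.add_apply, Pi.smul_apply, col_apply,
      MulOpposite.smul_eq_mul_unop, MulOpposite.unop_op]
    rw [mulVec, dotProduct, Finset.mul_sum, Finset.mul_sum, ← Finset.sum_sub_distrib,
      ← Finset.sum_add_distrib]
    refine Finset.sum_congr rfl fun i _ => ?_
    simp only [transpose_apply, Pi.sub_apply]
    ring
  have h2 : ∑ k, lam k * |(b + Pi.single j t : Fin p → ℝ) k| - ∑ k, lam k * |b k|
      = lam j * (|b j + t| - |b j|) := by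
    rw [← Finset.sum_sub_distrib, Finset.sum_eq_single j]
    · simp only [Pi.add_apply, Pi.single_eq_same]; ring
    · intro k _ hk
      simp [hk]
    · simp
  unfold lassoObjective
  rw [h1]
  linarith

/-- Karush–Kuhn–Tucker conditions for the Lasso. -/
lemma lasso_kkt {n p : ℕ} {y : Fin n → ℝ} {X : Matrix (Fin n) (Fin p) ℝ} {lam b : Fin p → ℝ}
    (h : ∀ b', lassoObjective y X lam b ≤ lassoObjective y X lam b') (j : Fin p) :
    |(Xᵀ *ᵥ (y - X *ᵥ b)) j| ≤ |lam j| ∧ (0 < b j → (Xᵀ *ᵥ (y - X *ᵥ b)) j = lam j) ∧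
      (b j < 0 → (Xᵀ *ᵥ (y - X *ᵥ b)) j = -lam j) := by
  refine subgradient_of_le_penalized_quadratic (a := ∑ i, X i j ^ 2) fun t => ?_
  have := h (b + Pi.single j t)
  rw [lassoObjective_add_single] at this
  linarith

/-- The Cramér–Wold device for Gaussian measures: `IsMvGaussian` determines the measure. -/
lemma IsMvGaussian.unique {p : ℕ} {μ μ' : Measure (Fin p → ℝ)} {m : Fin p → ℝ}
    {S : Matrix (Fin p) (Fin p) ℝ} (h : IsMvGaussian μ m S) (h' : IsMvGaussian μ' m S) :
    μ = μ' := by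
  have prob : ∀ {κ : Measure (Fin p → ℝ)}, IsMvGaussian κ m S → IsProbabilityMeasure κ := by
    intro κ hκ
    have : IsProbabilityMeasure (κ.map fun x => ∑ j, (0 : Fin p → ℝ) j * x j) := by
      rw [hκ 0]; infer_instance
    exact Measure.isProbabilityMeasure_of_map fun x => ∑ j, (0 : Fin p → ℝ) j * x j
  have := prob h
  have := prob h'
  refine Measure.ext_of_charFunDual (funext fun L => ?_)
  have hL : (L : (Fin p → ℝ) → ℝ) = fun x => ∑ j, L (Pi.single j 1) * x j := by
    ext x
    conv_lhs => rw [pi_eq_sum_univ' x, map_sum]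
    refine Finset.sum_congr rfl fun j _ => ?_
    rw [map_smul, smul_eq_mul, mul_comm]
  rw [charFunDual_eq_charFun_map_one, charFunDual_eq_charFun_map_one, hL,
    h fun j => L (Pi.single j 1), h' fun j => L (Pi.single j 1)]

/-- A linear combination of i.i.d. centered Gaussians is Gaussian. -/
lemma map_dotProduct_pi_gaussianReal {n : ℕ} (v : ℝ≥0) (a : Fin n → ℝ) :
    (Measure.pi fun _ : Fin n => gaussianReal 0 v).map (fun x => a ⬝ᵥ x)
      = gaussianReal 0 (Real.toNNReal (v * (a ⬝ᵥ a))) := by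
  have hmeas : Measurable fun x : Fin n → ℝ => a ⬝ᵥ x := by
    unfold dotProduct; fun_prop
  have : IsProbabilityMeasure
      ((Measure.pi fun _ : Fin n => gaussianReal 0 v).map (fun x => a ⬝ᵥ x)) :=
    Measure.isProbabilityMeasure_map hmeas.aemeasurable
  refine Measure.ext_of_charFun (funext fun t => ?_)
  rw [charFun_apply_real, integral_map hmeas.aemeasurable (by fun_prop), charFun_gaussianReal]
  have hprod : ∀ x : Fin n → ℝ, Complex.exp (t * (a ⬝ᵥ x : ℝ) * Complex.I)
      = ∏ i, Complex.exp ((t * a i : ℝ) * x i * Complex.I) := by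
    intro x
    rw [← Complex.exp_sum, dotProduct]
    congr 1
    push_cast
    rw [Finset.mul_sum, Finset.sum_mul]
    exact Finset.sum_congr rfl fun i _ => by ring
  simp_rw [hprod]
  rw [integral_fintype_prod_eq_prod
    (f := fun i (x : ℝ) => Complex.exp ((t * a i : ℝ) * x * Complex.I))]
  simp_rw [← charFun_apply_real, charFun_gaussianReal]
  rw [← Complex.exp_sum]
  congr 1
  have hnn : 0 ≤ (v : ℝ) * (a ⬝ᵥ a) :=
    mul_nonneg v.2 (Finset.sum_nonneg fun i _ => mul_self_nonneg _)
  rw [Real.coe_toNNReal _ hnn, dotProduct]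
  push_cast
  simp only [mul_zero, zero_mul, zero_sub]
  rw [Finset.sum_neg_distrib, ← Finset.sum_div, Finset.mul_sum, Finset.sum_mul]
  congr 2
  exact Finset.sum_congr rfl fun i _ => by ring

/-- Affine images of i.i.d. centered Gaussian vectors are Gaussian. -/
lemma isMvGaussian_map_affine {n p : ℕ} (v : ℝ≥0) (c : Fin p → ℝ)
    (A : Matrix (Fin p) (Fin n) ℝ) :
    IsMvGaussian ((Measure.pi fun _ : Fin n => gaussianReal 0 v).map fun x => A *ᵥ x + c)
      c ((v : ℝ) • (A * Aᵀ)) := by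
  intro l
  have hA : Measurable fun x : Fin n → ℝ => A *ᵥ x + c :=
    (Continuous.add (by fun_prop) continuous_const).measurable
  have hd : Measurable fun x : Fin n → ℝ => (l ᵥ* A) ⬝ᵥ x := by
    unfold dotProduct; fun_prop
  rw [Measure.map_map (by fun_prop) hA]
  have hfun : ((fun x : Fin p → ℝ => ∑ j, l j * x j) ∘ fun x => A *ᵥ x + c)
      = (fun s : ℝ => s + l ⬝ᵥ c) ∘ fun x => (l ᵥ* A) ⬝ᵥ x := by
    ext x
    change l ⬝ᵥ (A *ᵥ x + c) = _
    rw [dotProduct_add, dotProduct_mulVec]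
    rfl
  rw [hfun, ← Measure.map_map (by fun_prop) hd, map_dotProduct_pi_gaussianReal,
    gaussianReal_map_add_const, zero_add]
  have hvar : (l ᵥ* A) ⬝ᵥ (l ᵥ* A) = l ⬝ᵥ (A * Aᵀ) *ᵥ l := by
    rw [← mulVec_mulVec, dotProduct_mulVec, mulVec_transpose]
  rw [hvar, smul_mulVec, dotProduct_smul, smul_eq_mul]
  rfl

/-- The limiting error `C_n⁻¹ n^{-1/2} (X'e - Λd)` of the Lasso when all the components of `β`
are large and have the signs `d`. -/
def lassoLimitError {n p : ℕ} (X : Matrix (Fin n) (Fin p) ℝ) (lam d : Fin p → ℝ)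
    (e : Fin n → ℝ) : Fin p → ℝ :=
  ((n : ℝ)⁻¹ • (Xᵀ * X))⁻¹ *ᵥ ((Real.sqrt n)⁻¹ • (Xᵀ *ᵥ e - diagonal lam *ᵥ d))

lemma measurable_lassoLimitError {n p : ℕ} (X : Matrix (Fin n) (Fin p) ℝ)
    (lam d : Fin p → ℝ) : Measurable (lassoLimitError X lam d) := by
  have : Continuous (lassoLimitError X lam d) := by
    unfold lassoLimitError; fun_prop
  exact this.measurable

/-- The Gram matrix of a design of full column rank is invertible. -/
lemma isUnit_det_gram {n p : ℕ} (hn : 0 < n) {X : Matrix (Fin n) (Fin p) ℝ} (hX : X.rank = p) :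
    IsUnit ((n : ℝ)⁻¹ • (Xᵀ * X)).det := by
  have h : IsUnit (Xᵀ * X) := by
    rw [← mulVec_surjective_iff_isUnit, ← coe_mulVecLin, ← LinearMap.range_eq_top]
    refine Submodule.eq_top_of_finrank_eq ?_
    rw [Module.finrank_fin_fun]
    exact (Matrix.rank_transpose_mul_self X).trans hX
  rw [det_smul]
  exact (IsUnit.mk0 _ (by positivity)).mul ((isUnit_iff_isUnit_det _).1 h)

lemma isMvGaussian_map_lassoLimitError {n p : ℕ} (hn : 0 < n) {X : Matrix (Fin n) (Fin p) ℝ}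
    (hX : X.rank = p) (lam d : Fin p → ℝ) (v : ℝ≥0) :
    IsMvGaussian ((Measure.pi fun _ : Fin n => gaussianReal 0 v).map (lassoLimitError X lam d))
      (-((Real.sqrt n)⁻¹ • (((n : ℝ)⁻¹ • (Xᵀ * X))⁻¹ * diagonal lam).mulVec d))
      ((v : ℝ) • ((n : ℝ)⁻¹ • (Xᵀ * X))⁻¹) := by
  set C : Matrix (Fin p) (Fin p) ℝ := (n : ℝ)⁻¹ • (Xᵀ * X) with hC
  have hdet : IsUnit C.det := isUnit_det_gram hn hX
  have hCt : Cᵀ = C := by rw [hC, transpose_smul, transpose_mul, transpose_transpose]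
  have hfun : lassoLimitError X lam d = fun e => (C⁻¹ * ((Real.sqrt n)⁻¹ • Xᵀ)) *ᵥ e
      + -((Real.sqrt n)⁻¹ • (C⁻¹ * diagonal lam).mulVec d) := by
    ext1 e
    rw [lassoLimitError, ← hC, smul_sub, mulVec_sub, sub_eq_add_neg, ← mulVec_mulVec,
      smul_mulVec, mulVec_smul _ _ (diagonal lam *ᵥ d), mulVec_mulVec]
  have hcov : (C⁻¹ * ((Real.sqrt n)⁻¹ • Xᵀ)) * (C⁻¹ * ((Real.sqrt n)⁻¹ • Xᵀ))ᵀ = C⁻¹ := by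
    have hs : (Real.sqrt n)⁻¹ * (Real.sqrt n)⁻¹ = (n : ℝ)⁻¹ := by
      rw [← mul_inv, Real.mul_self_sqrt n.cast_nonneg]
    have hXX : ((Real.sqrt n)⁻¹ • Xᵀ) * ((Real.sqrt n)⁻¹ • X) = C := by
      rw [Matrix.smul_mul, Matrix.mul_smul, smul_smul, hs]
    rw [transpose_mul, transpose_nonsing_inv, hCt, transpose_smul, transpose_transpose,
      Matrix.mul_assoc, ← Matrix.mul_assoc _ _ C⁻¹, hXX, mul_nonsing_inv _ hdet, Matrix.mul_one]
  rw [hfun]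
  simpa only [hcov] using
    isMvGaussian_map_affine v (-((Real.sqrt n)⁻¹ • (C⁻¹ * diagonal lam).mulVec d))
      (C⁻¹ * ((Real.sqrt n)⁻¹ • Xᵀ))

/-- The normal equations for the scaled error of an estimator in terms of its residual score. -/
lemma gram_mulVec_scaled_error {n p : ℕ} (hn : 0 < n) (X : Matrix (Fin n) (Fin p) ℝ)
    (β b : Fin p → ℝ) (e : Fin n → ℝ) :
    ((n : ℝ)⁻¹ • (Xᵀ * X)) *ᵥ (Real.sqrt n • (b - β))
      = (Real.sqrt n)⁻¹ • (Xᵀ *ᵥ e - Xᵀ *ᵥ (X *ᵥ β + e - X *ᵥ b)) := by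
  have hs : (n : ℝ)⁻¹ * Real.sqrt n = (Real.sqrt n)⁻¹ := by
    have h0 : Real.sqrt n ≠ 0 := (Real.sqrt_pos.2 (by exact_mod_cast hn)).ne'
    field_simp
    exact Real.sq_sqrt n.cast_nonneg
  have h : X *ᵥ β + e - X *ᵥ b = e - X *ᵥ (b - β) := by
    rw [mulVec_sub]; abel
  rw [h, mulVec_sub, sub_sub_cancel, smul_mulVec, mulVec_smul, smul_smul, hs, mulVec_mulVec]

/-- Pointwise comparison: if the limiting error for the signs of `β` lies in a set satisfying
Condition A, then so does the scaled Lasso error. -/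
lemma scaled_error_mem_of_lassoLimitError_mem {n p : ℕ} (hn : 0 < n)
    {X : Matrix (Fin n) (Fin p) ℝ} (hX : X.rank = p) {lam : Fin p → ℝ} (hlam : ∀ j, 0 ≤ lam j)
    {M : Set (Fin p → ℝ)} (hM : CondA ((n : ℝ)⁻¹ • (Xᵀ * X)) M) {β b : Fin p → ℝ}
    {e : Fin n → ℝ}
    (hb : ∀ b', lassoObjective (X *ᵥ β + e) X lam b ≤ lassoObjective (X *ᵥ β + e) X lam b')
    (hmem : lassoLimitError X lam (fun j => if 0 ≤ β j then 1 else -1) e ∈ M) :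
    Real.sqrt n • (b - β) ∈ M := by
  set u : Fin p → ℝ := Real.sqrt n • (b - β) with hu
  have hsqrt : 0 < Real.sqrt n := Real.sqrt_pos.2 (by exact_mod_cast hn)
  refine hM (fun j => if u j ≤ 0 then 1 else -1) (fun j => ?_) _ hmem fun j => ⟨?_, ?_⟩
  · dsimp only; split_ifs <;> simp
  · obtain ⟨habs, hpos, hneg⟩ := lasso_kkt hb j
    rw [abs_of_nonneg (hlam j)] at habs
    obtain ⟨hlo, hhi⟩ := abs_le.1 habs
    have huj : u j = Real.sqrt n * (b j - β j) := rfl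
    rw [hu, gram_mulVec_scaled_error hn X β b e, ← hu, lassoLimitError, mulVec_mulVec,
      mul_nonsing_inv _ (isUnit_det_gram hn hX), one_mulVec]
    simp only [Pi.smul_apply, Pi.sub_apply, smul_eq_mul, mulVec_diagonal]
    set g := (Xᵀ *ᵥ (X *ᵥ β + e - X *ᵥ b)) j
    have hr : 0 < (Real.sqrt n)⁻¹ := inv_pos.2 hsqrt
    by_cases h1 : u j ≤ 0
    · rw [if_pos h1, one_mul, one_mul]
      refine mul_le_mul_of_nonneg_left ?_ hr.le
      by_cases h2 : 0 ≤ β j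
      · rw [if_pos h2]; linarith
      · have : b j < 0 := by
          by_contra! h3
          nlinarith
        rw [if_neg h2, hneg this]; linarith
    · rw [if_neg h1, neg_one_mul, neg_one_mul, neg_le_neg_iff]
      refine mul_le_mul_of_nonneg_left ?_ hr.le
      by_cases h2 : 0 ≤ β j
      · have : 0 < b j := by
          by_contra! h3
          nlinarith
        rw [if_pos h2, hpos this]; linarith
      · rw [if_neg h2]; linarith
  · dsimp only
    split_ifs with h <;> linarith

lemma scaled_error_eq {n p : ℕ} (hn : 0 < n) {X : Matrix (Fin n) (Fin p) ℝ} (hX : X.rank = p)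
    (β b : Fin p → ℝ) (e : Fin n → ℝ) :
    Real.sqrt n • (b - β) = ((n : ℝ)⁻¹ • (Xᵀ * X))⁻¹ *ᵥ
      ((Real.sqrt n)⁻¹ • (Xᵀ *ᵥ e - Xᵀ *ᵥ (X *ᵥ β + e - X *ᵥ b))) := by
  rw [← gram_mulVec_scaled_error hn X β b e, mulVec_mulVec,
    nonsing_inv_mul _ (isUnit_det_gram hn hX), one_mulVec]

/-- The scaled Lasso error is bounded uniformly in the true parameter. -/
lemma exists_bound_scaled_error {n p : ℕ} (hn : 0 < n) {X : Matrix (Fin n) (Fin p) ℝ}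
    (hX : X.rank = p) (lam : Fin p → ℝ) (e : Fin n → ℝ) :
    ∃ K : ℝ, ∀ β b : Fin p → ℝ,
      (∀ b', lassoObjective (X *ᵥ β + e) X lam b ≤ lassoObjective (X *ᵥ β + e) X lam b') →
      ∀ j, |Real.sqrt n * (b j - β j)| ≤ K := by
  have hcont : Continuous fun g : Fin p → ℝ =>
      ((n : ℝ)⁻¹ • (Xᵀ * X))⁻¹ *ᵥ ((Real.sqrt n)⁻¹ • (Xᵀ *ᵥ e - g)) := by fun_prop
  obtain ⟨K, hK⟩ := (isCompact_Icc (a := -|lam|) (b := |lam|)).exists_bound_of_continuousOn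
    hcont.continuousOn
  refine ⟨K, fun β b hb j => ?_⟩
  have h := hK (Xᵀ *ᵥ (X *ᵥ β + e - X *ᵥ b))
    ⟨fun j => (abs_le.1 (lasso_kkt hb j).1).1, fun j => (abs_le.1 (lasso_kkt hb j).1).2⟩
  rw [← scaled_error_eq hn hX] at h
  exact (norm_le_pi_norm (Real.sqrt n • (b - β)) j).trans h

/-- Along a ray in the orthant of signs `d`, the scaled Lasso error is eventually equal to its
limit. -/
lemma eventually_scaled_error_eq_lassoLimitError {n p : ℕ} (hn : 0 < n)
    {X : Matrix (Fin n) (Fin p) ℝ} (hX : X.rank = p) (lam : Fin p → ℝ) (e : Fin n → ℝ)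
    {d : Fin p → ℝ} (hd : IsSignVec d) {b : ℕ → Fin p → ℝ}
    (hb : ∀ (k : ℕ) b', lassoObjective (X *ᵥ ((k : ℝ) • d) + e) X lam (b k)
      ≤ lassoObjective (X *ᵥ ((k : ℝ) • d) + e) X lam b') :
    ∀ᶠ k : ℕ in atTop, Real.sqrt n • (b k - (k : ℝ) • d) = lassoLimitError X lam d e := by
  obtain ⟨K, hK⟩ := exists_bound_scaled_error hn hX lam e
  have hsqrt : 0 < Real.sqrt n := Real.sqrt_pos.2 (by exact_mod_cast hn)
  have hlim : Tendsto (fun k : ℕ => Real.sqrt n * (k : ℝ)) atTop atTop :=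
    tendsto_natCast_atTop_atTop.const_mul_atTop hsqrt
  filter_upwards [hlim.eventually_gt_atTop K] with k hk
  rw [scaled_error_eq hn hX _ _ e, lassoLimitError]
  congr 3
  ext j
  rw [mulVec_diagonal]
  obtain ⟨-, hpos, hneg⟩ := lasso_kkt (hb k) j
  obtain ⟨hlo, hhi⟩ := abs_le.1 (hK _ _ (hb k) j)
  simp only [Pi.smul_apply, smul_eq_mul] at hlo hhi
  rcases hd j with h | h
  · rw [h, mul_one] at hlo hhi ⊢
    refine hpos ?_
    by_contra! h3
    nlinarith
  · rw [h] at hlo hhi ⊢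
    rw [hneg, mul_neg_one]
    by_contra! h3
    nlinarith

/-- **Valid finite-sample confidence set based on the Lasso estimator.** If `M` is Borel
measurable, satisfies Condition A with `C_n = X'X/n`, and the minimum over sign vectors
`d` of the `N(−n^{−1/2}C_n⁻¹Λd, σ²C_n⁻¹)`-probability of `M` equals `1 − α`, then
`inf_β P_β(β ∈ β̂_L − n^{−1/2}M) = 1 − α`. -/
theorem lasso_confidence_set_finite_sample
    {Ω : Type*} [MeasurableSpace Ω] (P : Measure Ω) [IsProbabilityMeasure P]
    (n p : ℕ) (hn : 0 < n) (hp : 0 < p) (hpn : p ≤ n)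
    (X : Matrix (Fin n) (Fin p) ℝ) (hX : X.rank = p)
    (σ2 : ℝ≥0) (hσ : 0 < σ2)
    (ε : Ω → Fin n → ℝ) (hεmeas : Measurable ε)
    (hεdist : Measure.map ε P = Measure.pi fun _ : Fin n => gaussianReal 0 σ2)
    (lam : Fin p → ℝ) (hlam : ∀ j, 0 ≤ lam j)
    (βL : (Fin p → ℝ) → Ω → Fin p → ℝ)
    (hβLmeas : ∀ β, Measurable (βL β))
    (hβL : ∀ β ω b, lassoObjective (X.mulVec β + ε ω) X lam (βL β ω)
      ≤ lassoObjective (X.mulVec β + ε ω) X lam b)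
    (α : ℝ) (hα : 0 < α) (hα1 : α < 1)
    (M : Set (Fin p → ℝ)) (hM : MeasurableSet M)
    (hMA : CondA ((n : ℝ)⁻¹ • (Xᵀ * X)) M)
    -- the Gaussian measures `N(−n^{−1/2}C_n⁻¹Λd, σ²C_n⁻¹)`
    (ν : (Fin p → ℝ) → Measure (Fin p → ℝ))
    (hν : ∀ d, IsSignVec d → IsMvGaussian (ν d)
      (-((Real.sqrt n)⁻¹ • (((n : ℝ)⁻¹ • (Xᵀ * X))⁻¹ * Matrix.diagonal lam).mulVec d))
      ((σ2 : ℝ) • ((n : ℝ)⁻¹ • (Xᵀ * X))⁻¹))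
    (hmin : (⨅ (d : Fin p → ℝ) (_ : IsSignVec d), ν d M) = ENNReal.ofReal (1 - α)) :
    (⨅ β : Fin p → ℝ,
        P {ω | ∃ m ∈ M, β = βL β ω - (Real.sqrt n)⁻¹ • m}) = ENNReal.ofReal (1 - α) := by
  have hsqrt : Real.sqrt n ≠ 0 := (Real.sqrt_pos.2 (by exact_mod_cast hn)).ne'
  have hset : ∀ β, {ω | ∃ m ∈ M, β = βL β ω - (Real.sqrt n)⁻¹ • m}
      = {ω | Real.sqrt n • (βL β ω - β) ∈ M} := by
    intro β
    ext ω
    constructor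
    · rintro ⟨m, hm, h⟩
      have : βL β ω - β = (Real.sqrt n)⁻¹ • m := by
        nth_rewrite 2 [h]
        exact sub_sub_cancel _ _
      simpa only [mem_ofPred_eq, this, smul_inv_smul₀ hsqrt] using hm
    · intro h
      exact ⟨_, h, by rw [inv_smul_smul₀ hsqrt, sub_sub_cancel]⟩
  have hlimit : ∀ d, IsSignVec d → P {ω | lassoLimitError X lam d (ε ω) ∈ M} = ν d M := by
    intro d hd
    rw [(hν d hd).unique (isMvGaussian_map_lassoLimitError hn hX lam d σ2), ← hεdist,
      Measure.map_map (measurable_lassoLimitError X lam d) hεmeas,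
      Measure.map_apply ((measurable_lassoLimitError X lam d).comp hεmeas) hM]
    rfl
  simp_rw [hset]
  rw [← hmin]
  refine le_antisymm (le_iInf₂ fun d hd => ?_) (le_iInf fun β => ?_)
  · rw [← hlimit d hd]
    have hlim : Tendsto
        (fun k : ℕ => P {ω | Real.sqrt n • (βL ((k : ℝ) • d) ω - (k : ℝ) • d) ∈ M}) atTop
        (nhds (P {ω | lassoLimitError X lam d (ε ω) ∈ M})) := by
      refine tendsto_measure_of_tendsto_indicator_of_isFiniteMeasure atTop P
        (fun k => ?_) fun ω => ?_
      · have hβk := hβLmeas ((k : ℝ) • d)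
        have hmeas : Measurable fun ω => Real.sqrt n • (βL ((k : ℝ) • d) ω - (k : ℝ) • d) := by
          fun_prop
        exact hmeas hM
      filter_upwards [eventually_scaled_error_eq_lassoLimitError hn hX lam (ε ω) hd
        fun k => hβL ((k : ℝ) • d) ω] with k hk
      rw [hk]
    exact ge_of_tendsto' hlim fun k => iInf_le _ ((k : ℝ) • d)
  · refine (iInf₂_le (fun j => if 0 ≤ β j then (1 : ℝ) else -1) fun j => ?_).trans ?_
    · dsimp only; split_ifs <;> simp
    · rw [← hlimit _ fun j => by split_ifs <;> simp]
      exact measure_mono fun ω hω =>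
        scaled_error_mem_of_lassoLimitError_mem hn hX hlam hMA (hβL β ω) hω
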